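/- arXiv:2501.17400 — 2 statements merged into one kernel-verified Lean document; each statement's English description precedes it below -/
import Mathlib

section
/- Let A be a real n×n matrix, B a real n×m matrix, M a symmetric real n×n matrix, R an invertible symmetric real m×m matrix, and P a symmetric real n×n matrix satisfying the algebraic Riccati equation Aᵀ P + P A − P B R⁻¹ Bᵀ P + M = 0. Suppose x : ℝ → ℝⁿ and u : ℝ → ℝᵐ are such that for every t, x is differentiable at t with derivative x'(t) = A x(t) + B u(t). Then for every t, the function t ↦ x(t)ᵀ P x(t) is differentiable at t with derivative equal to x(t)ᵀ P B R⁻¹ Bᵀ P x(t) − x(t)ᵀ M x(t) + 2 x(t)ᵀ P B u(t). -/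
open Matrix

/-- Product rule for the dot product of two differentiable vector-valued functions. -/
theorem HasDerivAt.dotProduct_fun {ι : Type*} [Fintype ι] {f g : ℝ → ι → ℝ} {f' g' : ι → ℝ} {t : ℝ}
    (hf : HasDerivAt f f' t) (hg : HasDerivAt g g' t) :
    HasDerivAt (fun s => f s ⬝ᵥ g s) (f' ⬝ᵥ g t + f t ⬝ᵥ g') t := by
  simp only [dotProduct, ← Finset.sum_add_distrib]
  exact HasDerivAt.fun_sum fun i _ => (hasDerivAt_pi.1 hf i).mul (hasDerivAt_pi.1 hg i)

/-- A constant matrix commutes with differentiation. -/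
theorem HasDerivAt.const_mulVec {ι κ : Type*} [Fintype ι] [Fintype κ] (Q : Matrix κ ι ℝ)
    {f : ℝ → ι → ℝ} {f' : ι → ℝ} {t : ℝ} (hf : HasDerivAt f f' t) :
    HasDerivAt (fun s => Q.mulVec (f s)) (Q.mulVec f') t :=
  hasDerivAt_pi.2 fun i =>
    HasDerivAt.fun_sum fun j _ => (hasDerivAt_pi.1 hf j).const_mul (Q i j)

/-- The bilinear form of a symmetric matrix is symmetric. -/
theorem Matrix.IsSymm.dotProduct_mulVec_comm {ι : Type*} [Fintype ι] {Q : Matrix ι ι ℝ}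
    (hQ : Q.IsSymm) (v w : ι → ℝ) : v ⬝ᵥ Q.mulVec w = w ⬝ᵥ Q.mulVec v := by
  rw [dotProduct_mulVec, ← mulVec_transpose, hQ.eq, dotProduct_comm]

/-- Model-free dynamic equality: if `P` is symmetric and satisfies the algebraic Riccati
equation, then along any trajectory of `ẋ = A x + B u`, the candidate value function
`V(x) = xᵀ P x` has time derivative
`xᵀ P B R⁻¹ Bᵀ P x − xᵀ M x + 2 xᵀ P B u`, with no reference to `A`. -/
theorem model_free_value_deriv
    (n m : ℕ)
    (A : Matrix (Fin n) (Fin n) ℝ) (B : Matrix (Fin n) (Fin m) ℝ)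
    (M : Matrix (Fin n) (Fin n) ℝ) (hM : M.IsSymm)
    (R : Matrix (Fin m) (Fin m) ℝ) (hR : R.IsSymm) (hRinv : IsUnit R.det)
    (P : Matrix (Fin n) (Fin n) ℝ) (hP : P.IsSymm)
    (hARE : Aᵀ * P + P * A - P * B * R⁻¹ * Bᵀ * P + M = 0)
    (x : ℝ → Fin n → ℝ) (u : ℝ → Fin m → ℝ)
    (hx : ∀ t : ℝ, HasDerivAt x (A.mulVec (x t) + B.mulVec (u t)) t) :
    ∀ t : ℝ, HasDerivAt (fun s => x s ⬝ᵥ P.mulVec (x s))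
      (x t ⬝ᵥ (P * B * R⁻¹ * Bᵀ * P).mulVec (x t) - x t ⬝ᵥ M.mulVec (x t)
        + 2 * (x t ⬝ᵥ P.mulVec (B.mulVec (u t)))) t := by
  intro t
  have hS : P * B * R⁻¹ * Bᵀ * P = Aᵀ * P + P * A + M := by
    rw [← sub_eq_zero, ← neg_eq_zero, ← hARE]
    abel
  have hA : x t ⬝ᵥ (Aᵀ * P).mulVec (x t) = x t ⬝ᵥ P.mulVec (A.mulVec (x t)) := by
    rw [← mulVec_mulVec, dotProduct_mulVec, vecMul_transpose,
      hP.dotProduct_mulVec_comm]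
  convert (hx t).dotProduct_fun ((hx t).const_mulVec P) using 1
  rw [hP.dotProduct_mulVec_comm (A.mulVec (x t) + B.mulVec (u t)), hS]
  simp only [add_mulVec, mulVec_add, dotProduct_add, hA, ← mulVec_mulVec _ P A]
  ring
end

section
/- Let A be a real n×n matrix, B a real n×m matrix, M a symmetric real n×n matrix, R an invertible symmetric real m×m matrix, and P a symmetric real n×n matrix satisfying the algebraic Riccati equation Aᵀ P + P A − P B R⁻¹ Bᵀ P + M = 0. Suppose x : ℝ → ℝⁿ is continuously differentiable, u : ℝ → ℝᵐ is continuous, and x'(τ) = A x(τ) + B u(τ) for all τ. Then for every t ∈ ℝ and every T ≥ 0, x(t)ᵀ P x(t) + ∫_t^{t+T} (u(τ) + R⁻¹ Bᵀ P x(τ))ᵀ R (u(τ) + R⁻¹ Bᵀ P x(τ)) dτ = x(t+T)ᵀ P x(t+T) + ∫_t^{t+T} ( x(τ)ᵀ M x(τ) + u(τ)ᵀ R u(τ) ) dτ. -/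
open Matrix

theorem HasDerivAt.dotProduct_mulVec_self {ι : Type*} [Fintype ι] {P : Matrix ι ι ℝ}
    (hP : P.IsSymm) {x : ℝ → ι → ℝ} {x' : ι → ℝ} {t : ℝ} (hx : HasDerivAt x x' t) :
    HasDerivAt (fun s => x s ⬝ᵥ P *ᵥ x s) (2 * (x' ⬝ᵥ P *ᵥ x t)) t := by
  have hc := hasDerivAt_pi.1 hx
  have hPx (i : ι) : HasDerivAt (fun s => (P *ᵥ x s) i) ((P *ᵥ x') i) t :=
    HasDerivAt.fun_sum fun j _ => (hc j).const_mul (P i j)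
  have h : HasDerivAt (fun s => x s ⬝ᵥ P *ᵥ x s)
      (∑ i, (x' i * (P *ᵥ x t) i + x t i * (P *ᵥ x') i)) t :=
    HasDerivAt.fun_sum fun i _ => (hc i).mul (hPx i)
  convert h using 1
  rw [Finset.sum_add_distrib]
  change _ = x' ⬝ᵥ P *ᵥ x t + x t ⬝ᵥ P *ᵥ x'
  rw [dotProduct_mulVec (x t), ← mulVec_transpose, hP.eq, dotProduct_comm _ x', two_mul]

theorem riccati_completion_of_squares {n m : Type*} [Fintype n] [Fintype m] [DecidableEq m]
    {A : Matrix n n ℝ} {B : Matrix n m ℝ} {M : Matrix n n ℝ} {R : Matrix m m ℝ}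
    (hR : R.IsSymm) (hRinv : IsUnit R.det) {P : Matrix n n ℝ} (hP : P.IsSymm)
    (hARE : Aᵀ * P + P * A - P * B * R⁻¹ * Bᵀ * P + M = 0) (x : n → ℝ) (u : m → ℝ) :
    (u + R⁻¹ *ᵥ (Bᵀ *ᵥ (P *ᵥ x))) ⬝ᵥ R *ᵥ (u + R⁻¹ *ᵥ (Bᵀ *ᵥ (P *ᵥ x)))
      = 2 * ((A *ᵥ x + B *ᵥ u) ⬝ᵥ P *ᵥ x) + (x ⬝ᵥ M *ᵥ x + u ⬝ᵥ R *ᵥ u) := by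
  have hq := congrArg (fun N => x ⬝ᵥ N *ᵥ x) hARE
  simp only [add_mulVec, sub_mulVec, ← mulVec_mulVec, zero_mulVec, dotProduct_add,
    dotProduct_sub, dotProduct_zero] at hq
  have hPsymm (z : n → ℝ) : x ⬝ᵥ P *ᵥ z = P *ᵥ x ⬝ᵥ z := by
    rw [dotProduct_mulVec, ← mulVec_transpose, hP.eq]
  have hA : x ⬝ᵥ Aᵀ *ᵥ (P *ᵥ x) = A *ᵥ x ⬝ᵥ P *ᵥ x := by
    rw [dotProduct_mulVec, vecMul_transpose]
  rw [hA, hPsymm, hPsymm, dotProduct_comm (P *ᵥ x) (A *ᵥ x)] at hq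
  have hB (z : m → ℝ) : P *ᵥ x ⬝ᵥ B *ᵥ z = z ⬝ᵥ Bᵀ *ᵥ (P *ᵥ x) := by
    rw [dotProduct_mulVec, ← mulVec_transpose, dotProduct_comm]
  rw [hB] at hq
  rw [add_dotProduct (A *ᵥ x), dotProduct_comm (B *ᵥ u), hB]
  set w := Bᵀ *ᵥ (P *ᵥ x)
  have hRv : R *ᵥ (R⁻¹ *ᵥ w) = w := by
    rw [mulVec_mulVec, mul_nonsing_inv R hRinv, one_mulVec]
  have hvR : R⁻¹ *ᵥ w ⬝ᵥ R *ᵥ u = u ⬝ᵥ w := by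
    rw [dotProduct_mulVec, ← mulVec_transpose, hR.eq, hRv, dotProduct_comm]
  simp only [mulVec_add, add_dotProduct, dotProduct_add, hRv, hvR]
  linarith

/-- Paper's Lemma 2 (adaptation of Willems): if the symmetric `P` satisfies the ARE,
then along any trajectory of `ẋ = A x + B u`,
`V(x(t)) + ∫_t^{t+T} ‖u + R⁻¹ Bᵀ P x‖²_R = V(x(t+T)) + ∫_t^{t+T} (xᵀ M x + uᵀ R u)`. -/
theorem value_plus_advantage_integral
    (n m : ℕ)
    (A : Matrix (Fin n) (Fin n) ℝ) (B : Matrix (Fin n) (Fin m) ℝ)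
    (M : Matrix (Fin n) (Fin n) ℝ) (hM : M.IsSymm)
    (R : Matrix (Fin m) (Fin m) ℝ) (hR : R.IsSymm) (hRinv : IsUnit R.det)
    (P : Matrix (Fin n) (Fin n) ℝ) (hP : P.IsSymm)
    (hARE : Aᵀ * P + P * A - P * B * R⁻¹ * Bᵀ * P + M = 0)
    (x : ℝ → Fin n → ℝ) (u : ℝ → Fin m → ℝ)
    (hu : Continuous u)
    (hx : ∀ τ : ℝ, HasDerivAt x (A.mulVec (x τ) + B.mulVec (u τ)) τ) :
    ∀ (t T : ℝ), 0 ≤ T →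
      x t ⬝ᵥ P.mulVec (x t)
        + ∫ τ in t..(t + T),
            (u τ + R⁻¹.mulVec (Bᵀ.mulVec (P.mulVec (x τ)))) ⬝ᵥ
              R.mulVec (u τ + R⁻¹.mulVec (Bᵀ.mulVec (P.mulVec (x τ))))
      = x (t + T) ⬝ᵥ P.mulVec (x (t + T))
        + ∫ τ in t..(t + T), (x τ ⬝ᵥ M.mulVec (x τ) + u τ ⬝ᵥ R.mulVec (u τ)) := by
  intro t T _
  have hxc : Continuous x := continuous_iff_continuousAt.2 fun τ => (hx τ).continuousAt
  have hV : Continuous fun τ => 2 * ((A *ᵥ x τ + B *ᵥ u τ) ⬝ᵥ P *ᵥ x τ) := by fun_prop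
  have hl : Continuous fun τ => x τ ⬝ᵥ M *ᵥ x τ + u τ ⬝ᵥ R *ᵥ u τ := by fun_prop
  have hFTC := intervalIntegral.integral_eq_sub_of_hasDerivAt
    (fun τ _ => (hx τ).dotProduct_mulVec_self hP) (hV.intervalIntegrable t (t + T))
  simp only [riccati_completion_of_squares hR hRinv hP hARE]
  rw [intervalIntegral.integral_add (hV.intervalIntegrable _ _) (hl.intervalIntegrable _ _), hFTC]
  ring
end
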